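/- Assume f and g are twice continuously differentiable. Let (x̄,ȳ,ū,s̄) ∈ F_S be a local solution of SVF which is partially calm: there exist λ̃ > 0 and a neighborhood W of (x̄,ȳ,ū,s̄) such that F(x,y) + λ̃(f(x,y) − f(x,u)) ≥ F(x̄,ȳ) + λ̃(f(x̄,ȳ) − f(x̄,ū)) for every (x,y,u,s) ∈ W ∩ F̃. Suppose the MPEC-NNAMCQ holds for the system F̃ at (x̄,ȳ,ū,s̄): the only λ ∈ ℝ^m with λ_i ≥ 0 and λ_i = 0 for i ∉ I(x̄,ȳ), μ_φ ∈ ℝ^l and μ^g ∈ ℝ^m with μ^g_i = 0 for i ∉ I(x̄,ū), satisfying 0 = Σ_{i∈I(x̄,ȳ)} λ_i ∇₁g_i(x̄,ȳ) + [∇₂₁²f + Σ_{i∈I(x̄,ū)} s̄_i ∇₂₁²g_i](x̄,ū)ᵀμ_φ + Σ_{i∈I(x̄,ū)} μ^g_i ∇₁g_i(x̄,ū); 0 = Σ_{i∈I(x̄,ȳ)} λ_i ∇₂g_i(x̄,ȳ); 0 = Σ_{i∈I(x̄,ū)} μ^g_i ∇₂g_i(x̄,ū) + [∇₂₂²f +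 Σ_{i∈I(x̄,ū)} s̄_i ∇₂₂²g_i](x̄,ū)ᵀμ_φ; ⟨∇₂g_i(x̄,ū), μ_φ⟩ = 0 for i ∈ I_g(x̄,ū); and, for each i ∈ I_0(x̄,ū), either (μ^g_i > 0 and ⟨∇₂g_i(x̄,ū), μ_φ⟩ > 0) or μ^g_i·⟨∇₂g_i(x̄,ū), μ_φ⟩ = 0, is λ = 0, μ_φ = 0, μ^g = 0. Then there exist λ₀ > 0, λ ∈ ℝ^m with λ_i ≥ 0 and λ_i = 0 for i ∉ I(x̄,ȳ), μ_φ ∈ ℝ^l and μ^g ∈ ℝ^m with μ^g_i = 0 for i ∈ I_s(x̄,ū), satisfying the three W-stationarity gradient equations of SVF at (x̄,ȳ,ū,s̄) with these multipliers, ⟨∇₂g_i(x̄,ū), μ_φ⟩ = 0 for i ∈ I_g(x̄,ū), and the M-stationarity sign condition: for each i ∈ I_0(x̄,ū), either (μ^g_i > 0 and ⟨∇₂g_i(x̄,ū), μ_φ⟩ > 0) or μ^g_i·⟨∇₂g_i(x̄,ū), μ_φ⟩ = 0. -/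

import Mathlib

open scoped InnerProductSpace
open Filter Topology

noncomputable section

/-- Euclidean space ℝ^n. -/
abbrev E (n : ℕ) : Type := EuclideanSpace ℝ (Fin n)

variable {d l m : ℕ}

/-- Gradient with respect to the first argument. -/
noncomputable def grad1 (f : E d × E l → ℝ) (x : E d) (y : E l) : E d :=
  gradient (fun x' => f (x', y)) x

/-- Gradient with respect to the second argument. -/
noncomputable def grad2 (f : E d × E l → ℝ) (x : E d) (y : E l) : E l :=
  gradient (fun y' => f (x, y')) y

/-- The lower level feasible set `Y(x) = {y : g(x,y) ≤ 0}`. -/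
def Yset (g : Fin m → E d × E l → ℝ) (x : E d) : Set (E l) :=
  {y | ∀ i, g i (x, y) ≤ 0}

/-- The lower level solution set `S(x)`. -/
def Sset (f : E d × E l → ℝ) (g : Fin m → E d × E l → ℝ) (x : E d) : Set (E l) :=
  {y | y ∈ Yset g x ∧ ∀ y' ∈ Yset g x, f (x, y) ≤ f (x, y')}

/-- The lower level Lagrangian `L(x,u,s) = f(x,u) + Σᵢ sᵢ gᵢ(x,u)`. -/
noncomputable def Lag (f : E d × E l → ℝ) (g : Fin m → E d × E l → ℝ)
    (x : E d) (u : E l) (s : Fin m → ℝ) : ℝ :=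
  f (x, u) + ∑ i, s i * g i (x, u)

/-- The lower level multiplier set `M(x,u)`. -/
def Mset (f : E d × E l → ℝ) (g : Fin m → E d × E l → ℝ) (x : E d) (u : E l) :
    Set (Fin m → ℝ) :=
  {s | grad2 f x u + ∑ i, s i • grad2 (g i) x u = 0 ∧ (∀ i, 0 ≤ s i) ∧
       ∑ i, s i * g i (x, u) = 0}

/-- Assumption (A): pseudoconvexity of the lower level Lagrangian. -/
def AssumptionA (f : E d × E l → ℝ) (g : Fin m → E d × E l → ℝ) : Prop :=
  ∀ (x : E d), ∀ u1 ∈ Yset g x, ∀ u2 ∈ Yset g x, ∀ s ∈ Mset f g x u2,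
    0 ≤ ⟪u1 - u2, gradient (fun u' => Lag f g x u' s) u2⟫_ℝ →
    Lag f g x u2 s ≤ Lag f g x u1 s

/-- The lower level KKT conditions at `(x,u)` with multiplier `s`. -/
def LLKKT (f : E d × E l → ℝ) (g : Fin m → E d × E l → ℝ)
    (x : E d) (u : E l) (s : Fin m → ℝ) : Prop :=
  grad2 f x u + ∑ i, s i • grad2 (g i) x u = 0 ∧
  ∀ i, 0 ≤ s i ∧ g i (x, u) ≤ 0 ∧ s i * g i (x, u) = 0

/-- Membership in the feasible set `F_S` of the SVF formulation. -/
def FSmem (f : E d × E l → ℝ) (g : Fin m → E d × E l → ℝ)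
    (x : E d) (y u : E l) (s : Fin m → ℝ) : Prop :=
  f (x, y) - f (x, u) ≤ 0 ∧ LLKKT f g x u s ∧ ∀ i, g i (x, y) ≤ 0

/-- The value function `V(x) = inf {f(x,y) : y ∈ Y(x)}`. -/
noncomputable def Vval (f : E d × E l → ℝ) (g : Fin m → E d × E l → ℝ) (x : E d) : ℝ :=
  sInf ((fun y => f (x, y)) '' Yset g x)

/-- Smoothness data: `f`, `g` are `C¹` jointly, and `C²` in the second variable. -/
def SmoothData (f : E d × E l → ℝ) (g : Fin m → E d × E l → ℝ) : Prop :=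
  ContDiff ℝ 1 f ∧ (∀ i, ContDiff ℝ 1 (g i)) ∧
  (∀ x : E d, ContDiff ℝ 2 (fun y : E l => f (x, y))) ∧
  ∀ i, ∀ x : E d, ContDiff ℝ 2 (fun y : E l => g i (x, y))

/-- `[∇₂₁²f + Σᵢ cᵢ ∇₂₁²gᵢ](x,u)ᵀμ`: the gradient at `x` of
`x' ↦ ⟪∇₂f(x',u) + Σᵢ cᵢ ∇₂gᵢ(x',u), μ⟫` with `u` fixed. -/
noncomputable def grad21 (f : E d × E l → ℝ) (g : Fin m → E d × E l → ℝ)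
    (c : Fin m → ℝ) (μ : E l) (x : E d) (u : E l) : E d :=
  gradient (fun x' => ⟪grad2 f x' u + ∑ i, c i • grad2 (g i) x' u, μ⟫_ℝ) x

/-- `[∇₂₂²f + Σᵢ cᵢ ∇₂₂²gᵢ](x,u)ᵀμ`: the gradient at `u` of
`u' ↦ ⟪∇₂f(x,u') + Σᵢ cᵢ ∇₂gᵢ(x,u'), μ⟫` with `x` fixed. -/
noncomputable def grad22 (f : E d × E l → ℝ) (g : Fin m → E d × E l → ℝ)
    (c : Fin m → ℝ) (μ : E l) (x : E d) (u : E l) : E l :=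
  gradient (fun u' => ⟪grad2 f x u' + ∑ i, c i • grad2 (g i) x u', μ⟫_ℝ) u

/-- The three W-stationarity gradient equations of SVF at `(x,y,u,s)` with multipliers
`(lam0, lam, muphi, mug)`; the sums over active index sets are written as full sums,
the multipliers being required (separately) to vanish off the active sets. -/
noncomputable def WStatEqs (F f : E d × E l → ℝ) (g : Fin m → E d × E l → ℝ)
    (x : E d) (y u : E l) (s : Fin m → ℝ)
    (lam0 : ℝ) (lam : Fin m → ℝ) (muphi : E l) (mug : Fin m → ℝ) : Prop :=
  grad1 F x y + lam0 • (grad1 f x y - grad1 f x u) + ∑ i, lam i • grad1 (g i) x y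
      + grad21 f g s muphi x u + ∑ i, mug i • grad1 (g i) x u = 0 ∧
  grad2 F x y + lam0 • grad2 f x y + ∑ i, lam i • grad2 (g i) x y = 0 ∧
  -(lam0 • grad2 f x u) + ∑ i, mug i • grad2 (g i) x u + grad22 f g s muphi x u = 0

/-- Membership in `F̃`: all SVF constraints except `f(x,y) − f(x,u) ≤ 0`. -/
def Ftmem (f : E d × E l → ℝ) (g : Fin m → E d × E l → ℝ)
    (x : E d) (y u : E l) (s : Fin m → ℝ) : Prop :=
  LLKKT f g x u s ∧ ∀ i, g i (x, y) ≤ 0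

/-- Minimizers of the penalized functions `Ψ + k P` over a compact set converge to the strict
minimizer `a` of `Ψ` on the zero set of `P`. -/
theorem exists_penalty_minimizers {T : Type*} [TopologicalSpace T] {K : Set T} (hK : IsCompact K)
    {Ψ P : T → ℝ} (hΨ : Continuous Ψ) (hP : Continuous P) (hP0 : ∀ t, 0 ≤ P t)
    {a : T} (ha : a ∈ K) (hPa : P a = 0)
    (hmin : ∀ t ∈ K, P t = 0 → Ψ t ≤ Ψ a → t = a) :
    ∃ t : ℕ → T, (∀ k : ℕ, IsMinOn (fun z => Ψ z + (k : ℝ) * P z) K (t k)) ∧ (∀ k, t k ∈ K) ∧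
      Tendsto t atTop (𝓝 a) := by
  have hex : ∀ k : ℕ, ∃ t ∈ K, IsMinOn (fun z => Ψ z + k * P z) K t := fun k =>
    hK.exists_isMinOn ⟨a, ha⟩ (by fun_prop)
  choose t htK ht using hex
  refine ⟨t, ht, htK, ?_⟩
  rw [tendsto_nhds]
  intro U hU haU
  have hcomp : IsCompact (K \ U) := hK.diff hU
  have key : ∃ N : ℕ, ∀ k : ℕ, N ≤ k → ∀ z ∈ K \ U, Ψ a < Ψ z + k * P z := by
    refine hcomp.induction_on
      (p := fun S => ∃ N : ℕ, ∀ k : ℕ, N ≤ k → ∀ z ∈ S, Ψ a < Ψ z + k * P z) ?_ ?_ ?_ ?_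
    · exact ⟨0, by simp⟩
    · rintro S S' hSS' ⟨N, hN⟩
      exact ⟨N, fun k hk z hz => hN k hk z (hSS' hz)⟩
    · rintro S S' ⟨N, hN⟩ ⟨N', hN'⟩
      refine ⟨max N N', fun k hk z hz => ?_⟩
      rcases hz with hz | hz
      · exact hN k (le_trans (le_max_left _ _) hk) z hz
      · exact hN' k (le_trans (le_max_right _ _) hk) z hz
    · rintro z ⟨hzK, hzU⟩
      by_cases hΨz : Ψ a < Ψ z
      · refine ⟨{y | Ψ a < Ψ y}, mem_nhdsWithin_of_mem_nhds
          ((isOpen_lt continuous_const hΨ).mem_nhds hΨz), 0, fun k _ y hy => ?_⟩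
        have : 0 ≤ (k : ℝ) * P y := mul_nonneg k.cast_nonneg (hP0 y)
        have hy' : Ψ a < Ψ y := hy
        linarith
      · have hPz : 0 < P z := by
          refine lt_of_le_of_ne (hP0 z) fun h => hzU ?_
          rw [hmin z hzK h.symm (not_lt.mp hΨz)]
          exact haU
        obtain ⟨N, hN⟩ := exists_nat_gt ((Ψ a - Ψ z + 1) / (P z / 2))
        rw [div_lt_iff₀ (by positivity)] at hN
        refine ⟨{y | Ψ z - 1 < Ψ y} ∩ {y | P z / 2 < P y}, mem_nhdsWithin_of_mem_nhds
          (((isOpen_lt continuous_const hΨ).inter (isOpen_lt continuous_const hP)).mem_nhds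
            ⟨by simp, by simpa using hPz⟩), N, ?_⟩
        rintro k hk y ⟨hy1, hy2⟩
        have hy1' : Ψ z - 1 < Ψ y := hy1
        have hy2' : P z / 2 < P y := hy2
        have hk' : (N : ℝ) ≤ k := by exact_mod_cast hk
        have : (N : ℝ) * (P z / 2) ≤ k * P y := by gcongr
        linarith
  obtain ⟨N, hN⟩ := key
  filter_upwards [eventually_ge_atTop N] with k hk
  by_contra hkU
  have h1 := hN k hk (t k) ⟨htK k, hkU⟩
  have h2 : Ψ (t k) + k * P (t k) ≤ Ψ a + k * P a := ht k ha
  rw [hPa] at h2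
  linarith

theorem hasDerivAt_half_sq_max_zero (t : ℝ) :
    HasDerivAt (fun t : ℝ => (max t 0) ^ 2 / 2) (max t 0) t := by
  rcases lt_trichotomy t 0 with h | rfl | h
  · rw [max_eq_right h.le]
    refine (hasDerivAt_const t (0 : ℝ)).congr_of_eventuallyEq ?_
    filter_upwards [eventually_lt_nhds h] with y hy
    simp [max_eq_right hy.le]
  · rw [hasDerivAt_iff_isLittleO, max_self]
    have h2 : (fun x : ℝ => x ^ 2) =o[𝓝 0] fun x : ℝ => x := by
      simpa using Asymptotics.isLittleO_pow_id (𝕜 := ℝ) (n := 2) (by norm_num)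
    refine Asymptotics.IsBigO.trans_isLittleO ?_ (by simpa using h2)
    refine Asymptotics.IsBigO.of_bound 1 (Eventually.of_forall fun x => ?_)
    rcases le_total x 0 with hx | hx
    · simp [max_eq_right hx]; positivity
    · simp [max_eq_left hx]; nlinarith [sq_nonneg x]
  · rw [max_eq_left h.le]
    have h1 : HasDerivAt (fun t : ℝ => t ^ 2 / 2) t t := by
      simpa using ((hasDerivAt_pow 2 t).div_const 2)
    refine h1.congr_of_eventuallyEq ?_
    filter_upwards [eventually_gt_nhds h] with y hy
    simp [max_eq_left hy.le]

/-- First order condition for a one-dimensional minimization over the half-line `[0, ∞)`. -/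
theorem HasDerivAt.nonneg_and_eq_zero_of_isMinOn_nonneg {φ : ℝ → ℝ} {φ' t : ℝ}
    (hφ : HasDerivAt φ φ' t) (ht : 0 ≤ t) (hmin : ∀ᶠ r in 𝓝 t, 0 ≤ r → φ t ≤ φ r) :
    0 ≤ φ' ∧ (0 < t → φ' = 0) := by
  constructor
  · by_contra! hneg
    have h := (hasDerivAt_iff_tendsto_slope.mp hφ).eventually (eventually_lt_nhds hneg)
    have h1 : ∀ᶠ r in 𝓝[>] t, slope φ t r < 0 :=
      h.filter_mono (nhdsWithin_mono t fun r hr => ne_of_gt hr)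
    have h2 : ∀ᶠ r in 𝓝[>] t, 0 ≤ r → φ t ≤ φ r := hmin.filter_mono nhdsWithin_le_nhds
    obtain ⟨r, hr1, hr2, hr3⟩ := (h1.and (h2.and self_mem_nhdsWithin)).exists
    have hr3' : t < r := hr3
    rw [slope_def_field, div_lt_iff₀ (by linarith)] at hr1
    linarith [hr2 (by linarith)]
  · intro htpos
    refine IsLocalMin.hasDerivAt_eq_zero (f := φ) (a := t) ?_ hφ
    filter_upwards [hmin, eventually_gt_nhds htpos] with r h1 h2
    exact h1 h2.le

section FritzJohn

variable {X V ι : Type*} [NormedAddCommGroup V] [InnerProductSpace ℝ V] [Fintype ι]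

/-- First order conditions for one complementary pair `s, w ≥ 0`, `s w = 0`, where `A` and `B` are
the partial derivatives of the objective in `s` and `w`. -/
def ComplementaryStationary (s w A B : ℝ) : Prop :=
  0 ≤ s ∧ 0 ≤ w ∧ s * w = 0 ∧ (w = 0 → 0 ≤ A ∧ (0 < s → A = 0)) ∧
    (s = 0 → 0 ≤ B ∧ (0 < w → B = 0))

/-- The squared violation of `h₀ + ∑ sᵢ hᵢ = 0`, `p ≤ 0`, `q + w = 0`. -/
def sqViolation (h₀ : X → V) (h : ι → X → V) (p q : ι → X → ℝ) (z : X) (s w : ι → ℝ) : ℝ :=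
  ‖h₀ z + ∑ i, s i • h i z‖ ^ 2 / 2 + ∑ i, (max (p i z) 0) ^ 2 / 2 + ∑ i, (q i z + w i) ^ 2 / 2

/-- A regularized objective `Φ + ρ` plus the squared distance of `(s, w)` to `(sb, wb)`. -/
def proximalObjective (Φ ρ : X → ℝ) (sb wb : ι → ℝ) (z : X) (s w : ι → ℝ) : ℝ :=
  Φ z + ρ z + ∑ i, (s i - sb i) ^ 2 / 2 + ∑ i, (w i - wb i) ^ 2 / 2

theorem sqViolation_nonneg (h₀ : X → V) (h : ι → X → V) (p q : ι → X → ℝ) (z : X)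
    (s w : ι → ℝ) : 0 ≤ sqViolation h₀ h p q z s w := by
  unfold sqViolation; positivity

theorem sqViolation_eq_zero_iff (h₀ : X → V) (h : ι → X → V) (p q : ι → X → ℝ) (z : X)
    (s w : ι → ℝ) : sqViolation h₀ h p q z s w = 0 ↔
      h₀ z + ∑ i, s i • h i z = 0 ∧ (∀ i, p i z ≤ 0) ∧ ∀ i, q i z + w i = 0 := by
  unfold sqViolation
  rw [add_eq_zero_iff_of_nonneg (by positivity) (by positivity),
    add_eq_zero_iff_of_nonneg (by positivity) (by positivity),
    Finset.sum_eq_zero_iff_of_nonneg (fun _ _ => by positivity),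
    Finset.sum_eq_zero_iff_of_nonneg (fun _ _ => by positivity)]
  simp [and_assoc]

theorem hasDerivAt_sum_half_sq_update [DecidableEq ι] (s c : ι → ℝ) (i : ι) :
    HasDerivAt (fun t => ∑ j, (Function.update s i t j + c j) ^ 2 / 2) (s i + c i) (s i) := by
  have h1 : ∀ j, HasDerivAt (fun t => (Function.update s i t j + c j) ^ 2 / 2)
      ((s j + c j) * (Pi.single i 1 : ι → ℝ) j) (s i) := fun j => by
    have := (((hasDerivAt_pi.1 (hasDerivAt_update s i (s i)) j).add_const (c j)).pow 2).div_const 2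
    refine this.congr_deriv ?_
    simp only [Function.update_eq_self]
    ring
  have h2 := HasDerivAt.fun_sum (u := Finset.univ) fun j _ => h1 j
  simpa [Pi.single_apply] using h2

theorem hasDerivAt_sqViolation_update_left [DecidableEq ι] (h₀ : X → V) (h : ι → X → V)
    (p q : ι → X → ℝ) (z : X) (s w : ι → ℝ) (i : ι) :
    HasDerivAt (fun t => sqViolation h₀ h p q z (Function.update s i t) w)
      (inner ℝ (h i z) (h₀ z + ∑ i, s i • h i z)) (s i) := by
  unfold sqViolation
  have h1 : ∀ j, HasDerivAt (fun t => Function.update s i t j • h j z)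
      ((Pi.single i 1 : ι → ℝ) j • h j z) (s i) := fun j =>
    (hasDerivAt_pi.1 (hasDerivAt_update s i (s i)) j).smul_const (h j z)
  have h2 := HasDerivAt.fun_sum (u := Finset.univ) fun j _ => h1 j
  have h3 := ((h2.const_add (h₀ z)).norm_sq).div_const 2
  have h4 := (h3.add_const (∑ i, (max (p i z) 0) ^ 2 / 2)).add_const (∑ i, (q i z + w i) ^ 2 / 2)
  refine h4.congr_deriv ?_
  simp [Pi.single_apply, real_inner_comm]

theorem hasDerivAt_sqViolation_update_right [DecidableEq ι] (h₀ : X → V) (h : ι → X → V)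
    (p q : ι → X → ℝ) (z : X) (s w : ι → ℝ) (i : ι) :
    HasDerivAt (fun t => sqViolation h₀ h p q z s (Function.update w i t))
      (q i z + w i) (w i) := by
  unfold sqViolation
  have := (hasDerivAt_sum_half_sq_update w (fun j => q j z) i).const_add
    (‖h₀ z + ∑ i, s i • h i z‖ ^ 2 / 2 + ∑ i, (max (p i z) 0) ^ 2 / 2)
  simpa only [add_comm (w _)  _, add_comm (Function.update w i _ _) _] using this

variable [NormedAddCommGroup X] [NormedSpace ℝ X]

theorem hasFDerivAt_sqViolation {h₀ : X → V} {h : ι → X → V} {p q : ι → X → ℝ}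
    (hh₀ : Differentiable ℝ h₀) (hh : ∀ i, Differentiable ℝ (h i))
    (hp : ∀ i, Differentiable ℝ (p i)) (hq : ∀ i, Differentiable ℝ (q i))
    (z : X) (s w : ι → ℝ) :
    HasFDerivAt (fun z => sqViolation h₀ h p q z s w)
      ((innerSL ℝ (h₀ z + ∑ i, s i • h i z)).comp (fderiv ℝ h₀ z + ∑ i, s i • fderiv ℝ (h i) z)
        + ∑ i, (max (p i z) 0) • fderiv ℝ (p i) z + ∑ i, (q i z + w i) • fderiv ℝ (q i) z) z := by
  unfold sqViolation
  refine (HasFDerivAt.add ?_ ?_).add ?_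
  · have h1 : HasFDerivAt (fun z => h₀ z + ∑ i, s i • h i z)
        (fderiv ℝ h₀ z + ∑ i, s i • fderiv ℝ (h i) z) z :=
      (hh₀ z).hasFDerivAt.add (HasFDerivAt.fun_sum fun i _ =>
        (hh i z).hasFDerivAt.const_smul (s i))
    have h2 := h1.norm_sq.const_mul (1 / 2 : ℝ)
    refine (h2.congr_of_eventuallyEq (Eventually.of_forall fun v => ?_)).congr_fderiv ?_
    · ring
    · ext v; simp
  · exact HasFDerivAt.fun_sum fun i _ =>
      (hasDerivAt_half_sq_max_zero (p i z)).comp_hasFDerivAt z (hp i z).hasFDerivAt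
  · refine HasFDerivAt.fun_sum fun i _ => ?_
    have h1 : HasDerivAt (fun t : ℝ => (t + w i) ^ 2 / 2) (q i z + w i) (q i z) := by
      simpa using ((((hasDerivAt_id (q i z)).add_const (w i)).pow 2).div_const 2)
    exact h1.comp_hasFDerivAt z (hq i z).hasFDerivAt

/-- Approximate stationarity along a quadratic penalty scheme for a program with
complementarity constraints `0 ≤ s ⟂ -q(z) ≥ 0`. -/
theorem exists_approx_stationary_of_complementarity [ProperSpace X]
    {Φ ρ : X → ℝ} {h₀ : X → V} {h : ι → X → V} {p q : ι → X → ℝ}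
    (hΦ : ContDiff ℝ 1 Φ) (hρ : ContDiff ℝ 1 ρ) (hh₀ : ContDiff ℝ 1 h₀)
    (hh : ∀ i, ContDiff ℝ 1 (h i)) (hp : ∀ i, ContDiff ℝ 1 (p i)) (hq : ∀ i, ContDiff ℝ 1 (q i))
    {zb : X} {sb : ι → ℝ} (hρ0 : ∀ z, 0 ≤ ρ z) (hρb : ρ zb = 0) (hρz : ∀ z, ρ z = 0 → z = zb)
    (hfeas : h₀ zb + ∑ i, sb i • h i zb = 0) (hpb : ∀ i, p i zb ≤ 0)
    (hqb : ∀ i, 0 ≤ sb i ∧ q i zb ≤ 0 ∧ sb i * q i zb = 0)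
    (hopt : ∀ᶠ a in 𝓝 (zb, sb), h₀ a.1 + ∑ i, a.2 i • h i a.1 = 0 → (∀ i, p i a.1 ≤ 0) →
      (∀ i, 0 ≤ a.2 i ∧ q i a.1 ≤ 0 ∧ a.2 i * q i a.1 = 0) → Φ zb ≤ Φ a.1) :
    ∃ (z : ℕ → X) (s w lam : ℕ → ι → ℝ) (mu : ℕ → V) (nu : ℕ → ι → ℝ),
      Tendsto z atTop (𝓝 zb) ∧ Tendsto s atTop (𝓝 sb) ∧
      Tendsto w atTop (𝓝 fun i => - q i zb) ∧
      (∀ k i, 0 ≤ lam k i) ∧ (∀ k i, p i (z k) < 0 → lam k i = 0) ∧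
      ∀ᶠ k in atTop,
        fderiv ℝ Φ (z k) + fderiv ℝ ρ (z k)
          + ((innerSL ℝ (mu k)).comp (fderiv ℝ h₀ (z k) + ∑ i, s k i • fderiv ℝ (h i) (z k))
          + ∑ i, lam k i • fderiv ℝ (p i) (z k) + ∑ i, nu k i • fderiv ℝ (q i) (z k)) = 0 ∧
        ∀ i, ComplementaryStationary (s k i) (w k i)
          (inner ℝ (h i (z k)) (mu k) + (s k i - sb i)) (nu k i + (w k i + q i zb)) := by
  classical
  set wb : ι → ℝ := fun i => - q i zb with hwb
  have hΦc := hΦ.continuous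
  have hρc := hρ.continuous
  have hh₀c := hh₀.continuous
  have hhc := fun i => (hh i).continuous
  have hpc := fun i => (hp i).continuous
  have hqc := fun i => (hq i).continuous
  set C : Set (X × (ι → ℝ) × (ι → ℝ)) :=
    {t | ∀ i, 0 ≤ t.2.1 i ∧ 0 ≤ t.2.2 i ∧ t.2.1 i * t.2.2 i = 0} with hC
  have hCclosed : IsClosed C := by
    have h1 : ∀ i, Continuous fun t : X × (ι → ℝ) × (ι → ℝ) => t.2.1 i := fun i => by fun_prop
    have h2 : ∀ i, Continuous fun t : X × (ι → ℝ) × (ι → ℝ) => t.2.2 i := fun i => by fun_prop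
    rw [hC, Set.ofPred_forall]
    exact isClosed_iInter fun i => (isClosed_le continuous_const (h1 i)).inter
      ((isClosed_le continuous_const (h2 i)).inter
        (isClosed_eq ((h1 i).mul (h2 i)) continuous_const))
  have hopt' : ∀ᶠ t : X × (ι → ℝ) × (ι → ℝ) in 𝓝 (zb, sb, wb),
      h₀ t.1 + ∑ i, t.2.1 i • h i t.1 = 0 → (∀ i, p i t.1 ≤ 0) →
      (∀ i, 0 ≤ t.2.1 i ∧ q i t.1 ≤ 0 ∧ t.2.1 i * q i t.1 = 0) → Φ zb ≤ Φ t.1 := by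
    have hc : Tendsto (fun t : X × (ι → ℝ) × (ι → ℝ) => (t.1, t.2.1)) (𝓝 (zb, sb, wb))
        (𝓝 (zb, sb)) :=
      Continuous.tendsto (f := fun t : X × (ι → ℝ) × (ι → ℝ) => (t.1, t.2.1))
        (by fun_prop) (zb, sb, wb)
    exact hc.eventually hopt
  obtain ⟨ε, hε, hball⟩ := Metric.nhds_basis_closedBall.eventually_iff.mp hopt'
  set B := Metric.closedBall (zb, sb, wb) ε with hB
  obtain ⟨t, htmin, htK, htlim⟩ := exists_penalty_minimizers
    (K := B ∩ C) (Ψ := fun t => proximalObjective Φ ρ sb wb t.1 t.2.1 t.2.2)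
    (P := fun t => sqViolation h₀ h p q t.1 t.2.1 t.2.2) (a := (zb, sb, wb))
    ((isCompact_closedBall _ _).inter_right hCclosed)
    (by unfold proximalObjective; fun_prop) (by unfold sqViolation; fun_prop)
    (fun t => sqViolation_nonneg _ _ _ _ _ _ _)
    ⟨Metric.mem_closedBall_self hε.le, fun i => ⟨(hqb i).1, by simpa [hwb] using (hqb i).2.1,
      by simpa [hwb] using (hqb i).2.2⟩⟩
    ((sqViolation_eq_zero_iff _ _ _ _ _ _ _).2 ⟨hfeas, hpb, by simp [hwb]⟩)
    (by
      rintro ⟨z, s, w⟩ ⟨htB, htC⟩ hP hΨ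
      obtain ⟨h1, h2, h3⟩ := (sqViolation_eq_zero_iff _ _ _ _ _ _ _).1 hP
      have h3' : ∀ i, q i z = - w i := fun i => by linarith [h3 i]
      have hΦle : Φ zb ≤ Φ z := hball htB h1 h2 fun i => by
        obtain ⟨ha, hb, hc⟩ := htC i
        refine ⟨ha, ?_, ?_⟩
        · simpa [h3' i] using hb
        · simpa [h3' i] using hc
      simp only [proximalObjective, hρb, sub_self] at hΨ
      have hs0 : 0 ≤ ∑ i, (s i - sb i) ^ 2 / 2 := by positivity
      have hw0 : 0 ≤ ∑ i, (w i - wb i) ^ 2 / 2 := by positivity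
      have hz0 := hρ0 z
      simp at hΨ
      have hz := hρz z (by linarith)
      have hs1 : ∑ i, (s i - sb i) ^ 2 / 2 = 0 := by linarith
      have hw1 : ∑ i, (w i - wb i) ^ 2 / 2 = 0 := by linarith
      rw [Finset.sum_eq_zero_iff_of_nonneg (fun _ _ => by positivity)] at hs1 hw1
      have hs2 : s = sb := by
        ext i; have := hs1 i (Finset.mem_univ i); simpa [sub_eq_zero] using this
      have hw2 : w = wb := by
        ext i; have := hw1 i (Finset.mem_univ i); simpa [sub_eq_zero] using this
      rw [hz, hs2, hw2])
  refine ⟨fun k => (t k).1, fun k => (t k).2.1, fun k => (t k).2.2,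
    fun k i => k * max (p i (t k).1) 0,
    fun k => (k : ℝ) • (h₀ (t k).1 + ∑ i, (t k).2.1 i • h i (t k).1),
    fun k i => k * (q i (t k).1 + (t k).2.2 i),
    htlim.fst_nhds, htlim.snd_nhds.fst_nhds, htlim.snd_nhds.snd_nhds,
    fun k i => by positivity, fun k i hi => by simp [max_eq_right hi.le], ?_⟩
  have hint : ∀ᶠ k in atTop, B ∈ 𝓝 (t k) :=
    htlim.eventually (eventually_mem_nhds_iff.mpr (Metric.closedBall_mem_nhds _ hε))
  filter_upwards [hint] with k hk
  obtain ⟨-, htC⟩ := htK k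
  have hmin := isMinOn_iff.mp (htmin k)
  generalize t k = tk at *
  obtain ⟨z, s, w⟩ := tk
  dsimp only at *
  constructor
  · have hder : HasFDerivAt
        (fun z => proximalObjective Φ ρ sb wb z s w + k * sqViolation h₀ h p q z s w) _ z :=
      HasFDerivAt.add
        (((((hΦ.differentiable (by norm_num)) z).hasFDerivAt.add
          ((hρ.differentiable (by norm_num)) z).hasFDerivAt).add_const _).add_const _)
        ((hasFDerivAt_sqViolation (hh₀.differentiable (by norm_num))
          (fun i => (hh i).differentiable (by norm_num))
          (fun i => (hp i).differentiable (by norm_num))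
          (fun i => (hq i).differentiable (by norm_num)) z s w).const_mul (k : ℝ))
    have hlm : IsLocalMin
        (fun z => proximalObjective Φ ρ sb wb z s w + k * sqViolation h₀ h p q z s w) z := by
      have hc : Tendsto (fun y : X => (y, s, w)) (𝓝 z) (𝓝 (z, s, w)) :=
        Continuous.tendsto (f := fun y : X => (y, s, w)) (by fun_prop) z
      filter_upwards [hc.eventually hk] with y hy
      exact hmin (y, s, w) ⟨hy, htC⟩
    have := hlm.hasFDerivAt_eq_zero hder
    rw [← this]
    rw [map_smul, ContinuousLinearMap.smul_comp]
    simp only [mul_smul, ← Finset.smul_sum, ← smul_add]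
  · intro i
    obtain ⟨hsi, hwi, hswi⟩ := htC i
    refine ⟨hsi, hwi, hswi, fun hw0 => ?_, fun hs0 => ?_⟩
    · have hder : HasDerivAt (fun r => proximalObjective Φ ρ sb wb z (Function.update s i r) w
          + k * sqViolation h₀ h p q z (Function.update s i r) w)
          (inner ℝ (h i z) ((k : ℝ) • (h₀ z + ∑ i, s i • h i z)) + (s i - sb i)) (s i) := by
        have h1 := ((hasDerivAt_sum_half_sq_update s (fun j => - sb j) i).const_add
          (Φ z + ρ z)).add_const (∑ i, (w i - wb i) ^ 2 / 2)
        have h2 := h1.add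
          ((hasDerivAt_sqViolation_update_left h₀ h p q z s w i).const_mul (k : ℝ))
        refine h2.congr_deriv ?_
        rw [inner_smul_right]; ring
      refine hder.nonneg_and_eq_zero_of_isMinOn_nonneg hsi ?_
      have hc : Tendsto (fun r : ℝ => (z, Function.update s i r, w)) (𝓝 (s i))
          (𝓝 (z, s, w)) := by
        have : Continuous (fun r : ℝ => (z, Function.update s i r, w)) := by fun_prop
        simpa using this.tendsto (s i)
      filter_upwards [hc.eventually hk] with r hr hr0
      have := hmin (z, Function.update s i r, w) ⟨hr, fun j => by
        rcases eq_or_ne j i with rfl | hj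
        · simp [hr0, hw0]
        · simpa [hj] using htC j⟩
      simpa using this
    · have hder : HasDerivAt (fun r => proximalObjective Φ ρ sb wb z s (Function.update w i r)
          + k * sqViolation h₀ h p q z s (Function.update w i r))
          (k * (q i z + w i) + (w i + q i zb)) (w i) := by
        have h1 := (hasDerivAt_sum_half_sq_update w (fun j => - wb j) i).const_add
          (Φ z + ρ z + ∑ i, (s i - sb i) ^ 2 / 2)
        have h2 := h1.add
          ((hasDerivAt_sqViolation_update_right h₀ h p q z s w i).const_mul (k : ℝ))
        refine h2.congr_deriv ?_
        simp only [hwb]; ring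
      refine hder.nonneg_and_eq_zero_of_isMinOn_nonneg hwi ?_
      have hc : Tendsto (fun r : ℝ => (z, s, Function.update w i r)) (𝓝 (w i))
          (𝓝 (z, s, w)) := by
        have : Continuous (fun r : ℝ => (z, s, Function.update w i r)) := by fun_prop
        simpa using this.tendsto (w i)
      filter_upwards [hc.eventually hk] with r hr hr0
      have := hmin (z, s, Function.update w i r) ⟨hr, fun j => by
        rcases eq_or_ne j i with rfl | hj
        · simp [hr0, hs0]
        · simpa [hj] using htC j⟩
      simpa using this

/-- Limits of scaled first order conditions for a complementary pair are of M-type. -/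
theorem ComplementaryStationary.of_tendsto {κ : Type*} {L : Filter κ} [L.NeBot]
    {s w A B c : κ → ℝ} {sb wb a b : ℝ}
    (hst : ∀ᶠ k in L, ComplementaryStationary (s k) (w k) (A k) (B k)) (hc : ∀ k, 0 ≤ c k)
    (hs : Tendsto s L (𝓝 sb)) (hw : Tendsto w L (𝓝 wb))
    (hA : Tendsto (fun k => c k * A k) L (𝓝 a)) (hB : Tendsto (fun k => c k * B k) L (𝓝 b)) :
    (0 < sb → a = 0) ∧ (0 < wb → b = 0) ∧ ((0 < b ∧ 0 < a) ∨ b * a = 0) := by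
  have hs0 : a ≠ 0 → ∀ᶠ k in L, s k = 0 := fun ha => by
    filter_upwards [hst, hA.eventually_ne ha] with k ⟨h1, _, h3, h4, _⟩ hne
    by_contra hsk
    have hwk : w k = 0 := (mul_eq_zero.mp h3).resolve_left hsk
    exact hne (by rw [(h4 hwk).2 (lt_of_le_of_ne h1 (Ne.symm hsk)), mul_zero])
  have hw0 : b ≠ 0 → ∀ᶠ k in L, w k = 0 := fun hb => by
    filter_upwards [hst, hB.eventually_ne hb] with k ⟨_, h2, h3, _, h5⟩ hne
    by_contra hwk
    have hsk : s k = 0 := (mul_eq_zero.mp h3).resolve_right hwk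
    exact hne (by rw [(h5 hsk).2 (lt_of_le_of_ne h2 (Ne.symm hwk)), mul_zero])
  refine ⟨fun hpos => ?_, fun hpos => ?_, ?_⟩
  · by_contra ha
    obtain ⟨k, h1, h2⟩ := ((hs0 ha).and (hs.eventually_ne hpos.ne')).exists
    exact h2 h1
  · by_contra hb
    obtain ⟨k, h1, h2⟩ := ((hw0 hb).and (hw.eventually_ne hpos.ne')).exists
    exact h2 h1
  · by_cases ha : a = 0
    · right; simp [ha]
    by_cases hb : b = 0
    · right; simp [hb]
    left
    have hev : ∀ᶠ k in L, 0 ≤ c k * A k ∧ 0 ≤ c k * B k := by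
      filter_upwards [hst, hs0 ha, hw0 hb] with k ⟨_, _, _, h4, h5⟩ hsk hwk
      exact ⟨mul_nonneg (hc k) (h4 hwk).1, mul_nonneg (hc k) (h5 hsk).1⟩
    exact ⟨lt_of_le_of_ne (ge_of_tendsto hB (hev.mono fun _ h => h.2)) (Ne.symm hb),
      lt_of_le_of_ne (ge_of_tendsto hA (hev.mono fun _ h => h.1)) (Ne.symm ha)⟩

/-- The Fritz John type M-stationarity conditions at `(zb, sb)`, with multiplier `r` of the
objective `Φ`. -/
def FritzJohnM (Φ : X → ℝ) (h₀ : X → V) (h : ι → X → V) (p q : ι → X → ℝ) (zb : X) (sb : ι → ℝ)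
    (r : ℝ) (lam : ι → ℝ) (mu : V) (nu : ι → ℝ) : Prop :=
  (∀ i, 0 ≤ lam i) ∧ (∀ i, p i zb < 0 → lam i = 0) ∧
  r • fderiv ℝ Φ zb + ((innerSL ℝ mu).comp (fderiv ℝ h₀ zb + ∑ i, sb i • fderiv ℝ (h i) zb)
    + ∑ i, lam i • fderiv ℝ (p i) zb + ∑ i, nu i • fderiv ℝ (q i) zb) = 0 ∧
  ∀ i, (0 < sb i → inner ℝ (h i zb) mu = 0) ∧ (q i zb < 0 → nu i = 0) ∧
    ((0 < nu i ∧ 0 < inner ℝ (h i zb) mu) ∨ nu i * inner ℝ (h i zb) mu = 0)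

theorem FritzJohnM.of_tendsto {κ : Type*} {L : Filter κ} [L.NeBot]
    {Φ ρ : X → ℝ} {h₀ : X → V} {h : ι → X → V} {p q : ι → X → ℝ}
    (hΦ : ContDiff ℝ 1 Φ) (hρ : ContDiff ℝ 1 ρ) (hh₀ : ContDiff ℝ 1 h₀)
    (hh : ∀ i, ContDiff ℝ 1 (h i)) (hp : ∀ i, ContDiff ℝ 1 (p i)) (hq : ∀ i, ContDiff ℝ 1 (q i))
    {zb : X} {sb : ι → ℝ} (hρb : fderiv ℝ ρ zb = 0)
    {z : κ → X} {s w lam : κ → ι → ℝ} {mu : κ → V} {nu : κ → ι → ℝ}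
    (hz : Tendsto z L (𝓝 zb)) (hs : Tendsto s L (𝓝 sb))
    (hw : Tendsto w L (𝓝 fun i => - q i zb))
    (hlam : ∀ k i, 0 ≤ lam k i) (hlamp : ∀ k i, p i (z k) < 0 → lam k i = 0)
    (hstat : ∀ᶠ k in L, fderiv ℝ Φ (z k) + fderiv ℝ ρ (z k)
          + ((innerSL ℝ (mu k)).comp (fderiv ℝ h₀ (z k) + ∑ i, s k i • fderiv ℝ (h i) (z k))
          + ∑ i, lam k i • fderiv ℝ (p i) (z k) + ∑ i, nu k i • fderiv ℝ (q i) (z k)) = 0 ∧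
        ∀ i, ComplementaryStationary (s k i) (w k i)
          (inner ℝ (h i (z k)) (mu k) + (s k i - sb i)) (nu k i + (w k i + q i zb)))
    {c : κ → ℝ} (hc : ∀ k, 0 ≤ c k) {r : ℝ} {lamb nub : ι → ℝ} {mub : V}
    (hcr : Tendsto c L (𝓝 r)) (hclam : Tendsto (fun k => c k • lam k) L (𝓝 lamb))
    (hcmu : Tendsto (fun k => c k • mu k) L (𝓝 mub))
    (hcnu : Tendsto (fun k => c k • nu k) L (𝓝 nub)) :
    FritzJohnM Φ h₀ h p q zb sb r lamb mub nub := by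
  have hsi := tendsto_pi_nhds.1 hs
  have hwi := tendsto_pi_nhds.1 hw
  have hcl := tendsto_pi_nhds.1 hclam
  have hcn := tendsto_pi_nhds.1 hcnu
  have hd : ∀ {f : X → ℝ}, ContDiff ℝ 1 f →
      Tendsto (fun k => fderiv ℝ f (z k)) L (𝓝 (fderiv ℝ f zb)) :=
    fun hf => ((hf.continuous_fderiv (by norm_num)).tendsto zb).comp hz
  have hdV : ∀ {f : X → V}, ContDiff ℝ 1 f →
      Tendsto (fun k => fderiv ℝ f (z k)) L (𝓝 (fderiv ℝ f zb)) :=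
    fun hf => ((hf.continuous_fderiv (by norm_num)).tendsto zb).comp hz
  refine ⟨fun i => ?_, fun i hi => ?_, ?_, fun i => ?_⟩
  · exact ge_of_tendsto' (hcl i) fun k => mul_nonneg (hc k) (hlam k i)
  · refine tendsto_nhds_unique (hcl i) (tendsto_const_nhds.congr' ?_)
    filter_upwards [(((hp i).continuous.tendsto zb).comp hz).eventually (eventually_lt_nhds hi)]
      with k hk
    simp [hlamp k i hk]
  · have hlim : Tendsto (fun k => c k • fderiv ℝ Φ (z k) + c k • fderiv ℝ ρ (z k)
        + ((innerSL ℝ (c k • mu k)).comp (fderiv ℝ h₀ (z k) + ∑ i, s k i • fderiv ℝ (h i) (z k))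
        + ∑ i, (c k • lam k) i • fderiv ℝ (p i) (z k)
        + ∑ i, (c k • nu k) i • fderiv ℝ (q i) (z k))) L
        (𝓝 (r • fderiv ℝ Φ zb + r • fderiv ℝ ρ zb
        + ((innerSL ℝ mub).comp (fderiv ℝ h₀ zb + ∑ i, sb i • fderiv ℝ (h i) zb)
        + ∑ i, lamb i • fderiv ℝ (p i) zb + ∑ i, nub i • fderiv ℝ (q i) zb))) := by
      refine ((hcr.smul (hd hΦ)).add (hcr.smul (hd hρ))).add ((Tendsto.add ?_ ?_).add ?_)
      · have hcomp : Continuous fun T : (V →L[ℝ] ℝ) × (X →L[ℝ] V) => T.1.comp T.2 :=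
          continuous_fst.clm_comp continuous_snd
        exact (hcomp.tendsto (_, _)).comp
          ((((innerSL ℝ).continuous.tendsto mub).comp hcmu).prodMk_nhds
            ((hdV hh₀).add (tendsto_finsetSum _ fun i _ => (hsi i).smul (hdV (hh i)))))
      · exact tendsto_finsetSum _ fun i _ => (hcl i).smul (hd (hp i))
      · exact tendsto_finsetSum _ fun i _ => (hcn i).smul (hd (hq i))
    rw [hρb, smul_zero, add_zero] at hlim
    refine tendsto_nhds_unique hlim (tendsto_const_nhds.congr' ?_)
    filter_upwards [hstat] with k hk
    have := congrArg (c k • ·) hk.1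
    simp only [smul_zero] at this
    rw [← this]
    simp only [map_smul, ContinuousLinearMap.smul_comp, Pi.smul_apply, smul_eq_mul, mul_smul,
      Finset.smul_sum, smul_add]
  · have hA : Tendsto (fun k => c k * (inner ℝ (h i (z k)) (mu k) + (s k i - sb i))) L
        (𝓝 (inner ℝ (h i zb) mub)) := by
      have h1 := ((((hh i).continuous.tendsto zb).comp hz).inner hcmu).add
        (hcr.mul ((hsi i).sub_const (sb i)))
      rw [sub_self, mul_zero, add_zero] at h1
      refine h1.congr fun k => ?_
      simp only [Function.comp, inner_smul_right]
      ring
    have hB : Tendsto (fun k => c k * (nu k i + (w k i + q i zb))) L (𝓝 (nub i)) := by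
      have h1 := (hcn i).add (hcr.mul ((hwi i).add_const (q i zb)))
      rw [neg_add_cancel, mul_zero, add_zero] at h1
      refine h1.congr fun k => ?_
      simp only [Pi.smul_apply, smul_eq_mul]
      ring
    have := ComplementaryStationary.of_tendsto (hstat.mono fun k hk => hk.2 i) hc (hsi i) (hwi i)
      hA hB
    exact ⟨this.1, fun hi => this.2.1 (by linarith), this.2.2⟩

/-- A minimizer of a program with complementarity constraints satisfies M-stationarity conditions
of Fritz John type, with a nontrivial multiplier. -/
theorem exists_fritzJohnM_of_complementarity [ProperSpace X] [ProperSpace V]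
    {Φ ρ : X → ℝ} {h₀ : X → V} {h : ι → X → V} {p q : ι → X → ℝ}
    (hΦ : ContDiff ℝ 1 Φ) (hρ : ContDiff ℝ 1 ρ) (hh₀ : ContDiff ℝ 1 h₀)
    (hh : ∀ i, ContDiff ℝ 1 (h i)) (hp : ∀ i, ContDiff ℝ 1 (p i)) (hq : ∀ i, ContDiff ℝ 1 (q i))
    {zb : X} {sb : ι → ℝ} (hρ0 : ∀ z, 0 ≤ ρ z) (hρb : ρ zb = 0) (hρz : ∀ z, ρ z = 0 → z = zb)
    (hfeas : h₀ zb + ∑ i, sb i • h i zb = 0) (hpb : ∀ i, p i zb ≤ 0)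
    (hqb : ∀ i, 0 ≤ sb i ∧ q i zb ≤ 0 ∧ sb i * q i zb = 0)
    (hopt : ∀ᶠ a in 𝓝 (zb, sb), h₀ a.1 + ∑ i, a.2 i • h i a.1 = 0 → (∀ i, p i a.1 ≤ 0) →
      (∀ i, 0 ≤ a.2 i ∧ q i a.1 ≤ 0 ∧ a.2 i * q i a.1 = 0) → Φ zb ≤ Φ a.1) :
    ∃ (r : ℝ) (lam : ι → ℝ) (mu : V) (nu : ι → ℝ),
      (r = 1 ∨ (r = 0 ∧ ¬ (lam = 0 ∧ mu = 0 ∧ nu = 0))) ∧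
      FritzJohnM Φ h₀ h p q zb sb r lam mu nu := by
  obtain ⟨z, s, w, lam, mu, nu, hz, hs, hw, hlam, hlamp, hstat⟩ :=
    exists_approx_stationary_of_complementarity hΦ hρ hh₀ hh hp hq hρ0 hρb hρz hfeas hpb hqb hopt
  have hρ' : fderiv ℝ ρ zb = 0 :=
    IsLocalMin.fderiv_eq_zero (Eventually.of_forall fun z => by rw [hρb]; exact hρ0 z)
  set M : ℕ → ℝ × (ι → ℝ) × V × (ι → ℝ) := fun k => (1, lam k, mu k, nu k) with hM
  have hM1 : ∀ k, 1 ≤ ‖M k‖ := fun k => by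
    simp [hM]
  have hM0 : ∀ k, 0 < ‖M k‖ := fun k => lt_of_lt_of_le one_pos (hM1 k)
  obtain ⟨R, hR, φ, hφ, hlim⟩ :=
    (isCompact_sphere (0 : ℝ × (ι → ℝ) × V × (ι → ℝ)) 1).tendsto_subseq
    (x := fun k => ‖M k‖⁻¹ • M k) fun k => by
      rw [mem_sphere_zero_iff_norm, norm_smul, norm_inv, norm_norm, inv_mul_cancel₀ (hM0 k).ne']
  obtain ⟨r, lamb, mub, nub⟩ := R
  have hr : Tendsto (fun k => ‖M (φ k)‖⁻¹) atTop (𝓝 r) := by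
    simpa [hM, Function.comp_def] using hlim.fst_nhds
  have hl : Tendsto (fun k => ‖M (φ k)‖⁻¹ • lam (φ k)) atTop (𝓝 lamb) := hlim.snd_nhds.fst_nhds
  have hm : Tendsto (fun k => ‖M (φ k)‖⁻¹ • mu (φ k)) atTop (𝓝 mub) :=
    hlim.snd_nhds.snd_nhds.fst_nhds
  have hn : Tendsto (fun k => ‖M (φ k)‖⁻¹ • nu (φ k)) atTop (𝓝 nub) :=
    hlim.snd_nhds.snd_nhds.snd_nhds
  have hφt := hφ.tendsto_atTop
  have main := fun {c : ℕ → ℝ} => FritzJohnM.of_tendsto (c := c) hΦ hρ hh₀ hh hp hq hρ'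
    (hz.comp hφt) (hs.comp hφt)
    (hw.comp hφt) (fun k => hlam (φ k)) (fun k => hlamp (φ k)) (hφt.eventually hstat)
  by_cases hr0 : r = 0
  · refine ⟨r, lamb, mub, nub, Or.inr ⟨hr0, ?_⟩,
      main (fun k => inv_nonneg.2 (norm_nonneg _)) hr hl hm hn⟩
    rintro ⟨rfl, rfl, rfl⟩
    rw [hr0, mem_sphere_zero_iff_norm] at hR
    simp at hR
  · have hinv : Tendsto (fun k => ‖M (φ k)‖) atTop (𝓝 r⁻¹) := by
      simpa using hr.inv₀ hr0
    refine ⟨1, r⁻¹ • lamb, r⁻¹ • mub, r⁻¹ • nub, Or.inl rfl,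
      main (c := fun _ => 1) (fun _ => zero_le_one) tendsto_const_nhds
      ((hinv.smul hl).congr fun k => ?_) ((hinv.smul hm).congr fun k => ?_)
      ((hinv.smul hn).congr fun k => ?_)⟩ <;>
    simp only [smul_smul, mul_inv_cancel₀ (hM0 (φ k)).ne']

end FritzJohn

theorem inner_grad1 {f : E d × E l → ℝ} {x : E d} {y : E l}
    (hf : DifferentiableAt ℝ f (x, y)) (a : E d) :
    ⟪grad1 f x y, a⟫_ℝ = fderiv ℝ f (x, y) (a, 0) := by
  have h : HasFDerivAt (fun x' => f (x', y)) _ x :=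
    hf.hasFDerivAt.comp x (hasFDerivAt_prodMk_left x y)
  rw [grad1, gradient, InnerProductSpace.toDual_symm_apply, h.fderiv]
  simp

theorem inner_grad2 {f : E d × E l → ℝ} {x : E d} {y : E l}
    (hf : DifferentiableAt ℝ f (x, y)) (b : E l) :
    ⟪grad2 f x y, b⟫_ℝ = fderiv ℝ f (x, y) (0, b) := by
  have h : HasFDerivAt (fun y' => f (x, y')) _ y :=
    hf.hasFDerivAt.comp y (hasFDerivAt_prodMk_right x y)
  rw [grad2, gradient, InnerProductSpace.toDual_symm_apply, h.fderiv]
  simp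

theorem contDiff_grad2 {f : E d × E l → ℝ} (hf : ContDiff ℝ 2 f) :
    ContDiff ℝ 1 (fun z : E d × E l => grad2 f z.1 z.2) := by
  have h : (fun z : E d × E l => grad2 f z.1 z.2) = fun z =>
      (InnerProductSpace.toDual ℝ (E l)).symm
        ((fderiv ℝ f z).comp (ContinuousLinearMap.inr ℝ (E d) (E l))) := by
    funext z
    refine ext_inner_right ℝ fun b => ?_
    rw [inner_grad2 (hf.differentiable (by norm_num) _), InnerProductSpace.toDual_symm_apply]
    simp
  rw [h]
  exact (InnerProductSpace.toDual ℝ (E l)).symm.toContinuousLinearEquiv.contDiff.comp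
    ((hf.fderiv_right (by norm_num)).clm_comp contDiff_const)

theorem hasFDerivAt_inner_grad2_lagrangian {f : E d × E l → ℝ} {g : Fin m → E d × E l → ℝ}
    (hf : ContDiff ℝ 2 f) (hg : ∀ i, ContDiff ℝ 2 (g i)) (c : Fin m → ℝ) (μ : E l) (x : E d)
    (u : E l) :
    HasFDerivAt (fun z : E d × E l => ⟪grad2 f z.1 z.2 + ∑ i, c i • grad2 (g i) z.1 z.2, μ⟫_ℝ)
      ((innerSL ℝ μ).comp (fderiv ℝ (fun z : E d × E l => grad2 f z.1 z.2) (x, u)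
        + ∑ i, c i • fderiv ℝ (fun z : E d × E l => grad2 (g i) z.1 z.2) (x, u))) (x, u) := by
  have h1 := ((contDiff_grad2 hf).differentiable (by norm_num) (x, u)).hasFDerivAt.add
    (HasFDerivAt.fun_sum (u := Finset.univ) fun i _ =>
      (((contDiff_grad2 (hg i)).differentiable (by norm_num) (x, u)).hasFDerivAt.const_smul (c i)))
  refine ((innerSL ℝ μ).hasFDerivAt.comp (x, u) h1).congr_of_eventuallyEq
    (Eventually.of_forall fun z => ?_)
  simp [real_inner_comm]

theorem inner_grad21 {f : E d × E l → ℝ} {g : Fin m → E d × E l → ℝ}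
    (hf : ContDiff ℝ 2 f) (hg : ∀ i, ContDiff ℝ 2 (g i)) (c : Fin m → ℝ) (μ : E l) (x : E d)
    (u : E l) (a : E d) :
    ⟪grad21 f g c μ x u, a⟫_ℝ = ⟪μ, (fderiv ℝ (fun z : E d × E l => grad2 f z.1 z.2) (x, u)
        + ∑ i, c i • fderiv ℝ (fun z : E d × E l => grad2 (g i) z.1 z.2) (x, u)) (a, 0)⟫_ℝ := by
  have h : HasFDerivAt (fun x' => ⟪grad2 f x' u + ∑ i, c i • grad2 (g i) x' u, μ⟫_ℝ) _ x :=
    HasFDerivAt.comp (f := fun x' => (x', u)) x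
      (hasFDerivAt_inner_grad2_lagrangian hf hg c μ x u) (hasFDerivAt_prodMk_left x u)
  rw [grad21, gradient, h.fderiv, InnerProductSpace.toDual_symm_apply]
  simp [inner_add_right, inner_sum, real_inner_smul_right]

theorem inner_grad22 {f : E d × E l → ℝ} {g : Fin m → E d × E l → ℝ}
    (hf : ContDiff ℝ 2 f) (hg : ∀ i, ContDiff ℝ 2 (g i)) (c : Fin m → ℝ) (μ : E l) (x : E d)
    (u : E l) (b : E l) :
    ⟪grad22 f g c μ x u, b⟫_ℝ = ⟪μ, (fderiv ℝ (fun z : E d × E l => grad2 f z.1 z.2) (x, u)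
        + ∑ i, c i • fderiv ℝ (fun z : E d × E l => grad2 (g i) z.1 z.2) (x, u)) (0, b)⟫_ℝ := by
  have h : HasFDerivAt (fun u' => ⟪grad2 f x u' + ∑ i, c i • grad2 (g i) x u', μ⟫_ℝ) _ u :=
    HasFDerivAt.comp (f := fun u' => (x, u')) u
      (hasFDerivAt_inner_grad2_lagrangian hf hg c μ x u) (hasFDerivAt_prodMk_right x u)
  rw [grad22, gradient, h.fderiv, InnerProductSpace.toDual_symm_apply]
  simp [inner_add_right, inner_sum, real_inner_smul_right]

theorem fderiv_comp_fst_prod_snd_fst {W : Type*} [NormedAddCommGroup W] [NormedSpace ℝ W]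
    {f : E d × E l → W} {z : E d × E l × E l} (hf : DifferentiableAt ℝ f (z.1, z.2.1))
    (v : E d × E l × E l) :
    fderiv ℝ (fun z : E d × E l × E l => f (z.1, z.2.1)) z v =
      fderiv ℝ f (z.1, z.2.1) (v.1, v.2.1) := by
  have h : HasFDerivAt (fun z : E d × E l × E l => f (z.1, z.2.1)) _ z :=
    HasFDerivAt.comp (f := fun z : E d × E l × E l => (z.1, z.2.1)) z hf.hasFDerivAt
      (hasFDerivAt_fst.prodMk hasFDerivAt_snd.fst)
  rw [h.fderiv]
  simp

theorem fderiv_comp_fst_prod_snd_snd {W : Type*} [NormedAddCommGroup W] [NormedSpace ℝ W]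
    {f : E d × E l → W} {z : E d × E l × E l} (hf : DifferentiableAt ℝ f (z.1, z.2.2))
    (v : E d × E l × E l) :
    fderiv ℝ (fun z : E d × E l × E l => f (z.1, z.2.2)) z v =
      fderiv ℝ f (z.1, z.2.2) (v.1, v.2.2) := by
  have h : HasFDerivAt (fun z : E d × E l × E l => f (z.1, z.2.2)) _ z :=
    HasFDerivAt.comp (f := fun z : E d × E l × E l => (z.1, z.2.2)) z hf.hasFDerivAt
      (hasFDerivAt_fst.prodMk hasFDerivAt_snd.snd)
  rw [h.fderiv]
  simp

/-- The gradient equations encoded by the stationarity equation of `FritzJohnM` for the partially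
penalized surrogate value function problem. -/
theorem gradient_equations_of_fritzJohnM
    {F f : E d × E l → ℝ} {g : Fin m → E d × E l → ℝ}
    (hF : ContDiff ℝ 1 F) (hf : ContDiff ℝ 2 f) (hg : ∀ i, ContDiff ℝ 2 (g i))
    {xb : E d} {yb ub : E l} {sb : Fin m → ℝ} {lamt r : ℝ} {lam nu : Fin m → ℝ} {mu : E l}
    (hFJ : FritzJohnM
      (fun z : E d × E l × E l => F (z.1, z.2.1) + lamt * (f (z.1, z.2.1) - f (z.1, z.2.2)))
      (fun z => grad2 f z.1 z.2.2) (fun i z => grad2 (g i) z.1 z.2.2)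
      (fun i z => g i (z.1, z.2.1)) (fun i z => g i (z.1, z.2.2)) (xb, yb, ub) sb r lam mu nu) :
    r • (grad1 F xb yb + lamt • (grad1 f xb yb - grad1 f xb ub)) + ∑ i, lam i • grad1 (g i) xb yb
      + grad21 f g sb mu xb ub + ∑ i, nu i • grad1 (g i) xb ub = 0 ∧
    r • (grad2 F xb yb + lamt • grad2 f xb yb) + ∑ i, lam i • grad2 (g i) xb yb = 0 ∧
    r • -(lamt • grad2 f xb ub) + ∑ i, nu i • grad2 (g i) xb ub + grad22 f g sb mu xb ub = 0 := by
  have hFd : Differentiable ℝ F := hF.differentiable (by norm_num)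
  have hfd : Differentiable ℝ f := hf.differentiable (by norm_num)
  have hgd := fun i => (hg i).differentiable (by norm_num)
  have hfd' := (contDiff_grad2 hf).differentiable (by norm_num)
  have hgd' := fun i => (contDiff_grad2 (hg i)).differentiable (by norm_num)
  have hΦ : ∀ v : E d × E l × E l, fderiv ℝ
      (fun z : E d × E l × E l => F (z.1, z.2.1) + lamt * (f (z.1, z.2.1) - f (z.1, z.2.2)))
      (xb, yb, ub) v = fderiv ℝ F (xb, yb) (v.1, v.2.1)
        + lamt * (fderiv ℝ f (xb, yb) (v.1, v.2.1) - fderiv ℝ f (xb, ub) (v.1, v.2.2)) := by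
    intro v
    rw [fderiv_fun_add (by fun_prop) (by fun_prop), fderiv_const_mul (by fun_prop),
      fderiv_fun_sub (by fun_prop) (by fun_prop)]
    simp only [add_apply, smul_apply,
      sub_apply, smul_eq_mul]
    rw [fderiv_comp_fst_prod_snd_fst (hFd _), fderiv_comp_fst_prod_snd_fst (hfd _),
      fderiv_comp_fst_prod_snd_snd (hfd _)]
  have key : ∀ (a : E d) (b c : E l),
      r * (fderiv ℝ F (xb, yb) (a, b)
        + lamt * (fderiv ℝ f (xb, yb) (a, b) - fderiv ℝ f (xb, ub) (a, c)))
      + (⟪mu, (fderiv ℝ (fun z : E d × E l => grad2 f z.1 z.2) (xb, ub)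
        + ∑ i, sb i • fderiv ℝ (fun z : E d × E l => grad2 (g i) z.1 z.2) (xb, ub)) (a, c)⟫_ℝ
      + ∑ i, lam i * fderiv ℝ (g i) (xb, yb) (a, b)
      + ∑ i, nu i * fderiv ℝ (g i) (xb, ub) (a, c)) = 0 := by
    intro a b c
    have h := DFunLike.congr_fun hFJ.2.2.1 (a, b, c)
    simp only [add_apply, smul_apply,
      sum_apply, ContinuousLinearMap.comp_apply, smul_eq_mul, hΦ,
      innerSL_apply_apply, zero_apply,
      fderiv_comp_fst_prod_snd_fst (hgd _ _), fderiv_comp_fst_prod_snd_snd (hgd _ _),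
      fderiv_comp_fst_prod_snd_snd (f := fun z : E d × E l => grad2 f z.1 z.2) (hfd' _),
      fderiv_comp_fst_prod_snd_snd (f := fun z : E d × E l => grad2 (g _) z.1 z.2) (hgd' _ _)] at h
    simpa only [add_apply, smul_apply,
      sum_apply] using h
  refine ⟨ext_inner_right ℝ fun a => ?_, ext_inner_right ℝ fun b => ?_,
    ext_inner_right ℝ fun c => ?_⟩
  · simp only [inner_add_left, inner_sub_left, sum_inner, real_inner_smul_left, inner_zero_left,
      inner_grad1 (hFd _), inner_grad1 (hfd _), inner_grad1 (hgd _ _), inner_grad21 hf hg]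
    linarith [key a 0 0]
  · simp only [inner_add_left, sum_inner, real_inner_smul_left, inner_zero_left,
      inner_grad2 (hFd _), inner_grad2 (hfd _), inner_grad2 (hgd _ _)]
    have := key 0 b 0
    simp only [Prod.mk_zero_zero, map_zero, inner_zero_right, mul_zero, Finset.sum_const_zero]
      at this
    linarith
  · simp only [inner_add_left, inner_neg_left, sum_inner, real_inner_smul_left, inner_zero_left,
      inner_grad2 (hfd _), inner_grad2 (hgd _ _), inner_grad22 hf hg]
    have := key 0 0 c
    simp only [Prod.mk_zero_zero, map_zero, mul_zero, Finset.sum_const_zero] at this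
    linarith

/-- a partially calm local solution of SVF at which MPEC-NNAMCQ holds for
the system `F̃` is an M-stationary point of SVF. -/
theorem partially_calm_local_solution_is_M_stationary
    {d l m : ℕ} (hd : 0 < d) (hl : 0 < l) (hm : 0 < m)
    (F f : E d × E l → ℝ) (g : Fin m → E d × E l → ℝ)
    (hF : ContDiff ℝ 1 F) (hf : ContDiff ℝ 2 f) (hg : ∀ i, ContDiff ℝ 2 (g i))
    (xb : E d) (yb ub : E l) (sb : Fin m → ℝ)
    (hFS : FSmem f g xb yb ub sb)
    -- (x̄,ȳ,ū,s̄) is a local solution of SVF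
    (hloc : ∃ W : Set (E d × E l × E l × (Fin m → ℝ)), IsOpen W ∧
      (xb, yb, ub, sb) ∈ W ∧
      ∀ (x : E d) (y u : E l) (s : Fin m → ℝ),
        (x, y, u, s) ∈ W → FSmem f g x y u s → F (xb, yb) ≤ F (x, y))
    -- partial calmness of SVF at (x̄,ȳ,ū,s̄)
    (hcalm : ∃ lamt : ℝ, 0 < lamt ∧
      ∃ W : Set (E d × E l × E l × (Fin m → ℝ)), IsOpen W ∧ (xb, yb, ub, sb) ∈ W ∧
        ∀ (x : E d) (y u : E l) (s : Fin m → ℝ),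
          (x, y, u, s) ∈ W → Ftmem f g x y u s →
          F (xb, yb) + lamt * (f (xb, yb) - f (xb, ub)) ≤
            F (x, y) + lamt * (f (x, y) - f (x, u)))
    -- MPEC-NNAMCQ for the system F̃ at (x̄,ȳ,ū,s̄)
    (hnnamcq : ∀ (lam : Fin m → ℝ) (muphi : E l) (mug : Fin m → ℝ),
      (∀ i, 0 ≤ lam i) →
      (∀ i, g i (xb, yb) ≠ 0 → lam i = 0) →
      (∀ i, g i (xb, ub) ≠ 0 → mug i = 0) →
      (∑ i, lam i • grad1 (g i) xb yb + grad21 f g sb muphi xb ub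
        + ∑ i, mug i • grad1 (g i) xb ub = 0) →
      (∑ i, lam i • grad2 (g i) xb yb = 0) →
      (∑ i, mug i • grad2 (g i) xb ub + grad22 f g sb muphi xb ub = 0) →
      (∀ i, g i (xb, ub) = 0 → 0 < sb i → ⟪grad2 (g i) xb ub, muphi⟫_ℝ = 0) →
      (∀ i, g i (xb, ub) = 0 → sb i = 0 →
        (0 < mug i ∧ 0 < ⟪grad2 (g i) xb ub, muphi⟫_ℝ) ∨
        mug i * ⟪grad2 (g i) xb ub, muphi⟫_ℝ = 0) →
      lam = 0 ∧ muphi = 0 ∧ mug = 0) :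
    -- M-stationarity of (x̄,ȳ,ū,s̄) for SVF
    ∃ (lam0 : ℝ) (lam : Fin m → ℝ) (muphi : E l) (mug : Fin m → ℝ),
      0 < lam0 ∧ (∀ i, 0 ≤ lam i) ∧
      (∀ i, g i (xb, yb) ≠ 0 → lam i = 0) ∧
      (∀ i, g i (xb, ub) < 0 ∧ sb i = 0 → mug i = 0) ∧
      WStatEqs F f g xb yb ub sb lam0 lam muphi mug ∧
      (∀ i, g i (xb, ub) = 0 → 0 < sb i → ⟪grad2 (g i) xb ub, muphi⟫_ℝ = 0) ∧
      (∀ i, g i (xb, ub) = 0 → sb i = 0 →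
        (0 < mug i ∧ 0 < ⟪grad2 (g i) xb ub, muphi⟫_ℝ) ∨
        mug i * ⟪grad2 (g i) xb ub, muphi⟫_ℝ = 0) := by
  obtain ⟨-, ⟨hkkt, hcomp⟩, hgy⟩ := hFS
  obtain ⟨lamt, hlamt, W, hWo, hW, hcalmW⟩ := hcalm
  have hg1 : ∀ i, ContDiff ℝ 1 (g i) := fun i => (hg i).of_le (by norm_num)
  have hf1 : ContDiff ℝ 1 f := hf.of_le (by norm_num)
  have hy : ContDiff ℝ 1 fun z : E d × E l × E l => (z.1, z.2.1) := by fun_prop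
  have hu : ContDiff ℝ 1 fun z : E d × E l × E l => (z.1, z.2.2) := by fun_prop
  obtain ⟨r, lam, mu, nu, hr, hFJ⟩ := exists_fritzJohnM_of_complementarity
    (Φ := fun z : E d × E l × E l => F (z.1, z.2.1) + lamt * (f (z.1, z.2.1) - f (z.1, z.2.2)))
    (ρ := fun z : E d × E l × E l => ‖z.1 - xb‖ ^ 2 + ‖z.2.1 - yb‖ ^ 2 + ‖z.2.2 - ub‖ ^ 2)
    (h₀ := fun z => grad2 f z.1 z.2.2) (h := fun i z => grad2 (g i) z.1 z.2.2)
    (p := fun i z => g i (z.1, z.2.1)) (q := fun i z => g i (z.1, z.2.2))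
    (zb := (xb, yb, ub)) (sb := sb)
    ((hF.comp hy).add (contDiff_const.mul ((hf1.comp hy).sub (hf1.comp hu))))
    ((((contDiff_fst.sub contDiff_const).norm_sq ℝ).add
      ((contDiff_snd.fst.sub contDiff_const).norm_sq ℝ)).add
      ((contDiff_snd.snd.sub contDiff_const).norm_sq ℝ))
    ((contDiff_grad2 hf).comp hu) (fun i => (contDiff_grad2 (hg i)).comp hu)
    (fun i => (hg1 i).comp hy) (fun i => (hg1 i).comp hu)
    (fun z => by positivity) (by simp)
    (by
      rintro ⟨x, y, u⟩ h
      have hx := sq_nonneg ‖x - xb‖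
      have hy := sq_nonneg ‖y - yb‖
      have hu := sq_nonneg ‖u - ub‖
      dsimp only at h
      have hx0 : ‖x - xb‖ ^ 2 = 0 := by linarith
      have hy0 : ‖y - yb‖ ^ 2 = 0 := by linarith
      have hu0 : ‖u - ub‖ ^ 2 = 0 := by linarith
      simp only [ne_eq, OfNat.ofNat_ne_zero, not_false_eq_true, pow_eq_zero_iff, norm_eq_zero,
        sub_eq_zero] at hx0 hy0 hu0
      rw [hx0, hy0, hu0])
    hkkt hgy hcomp
    (by
      have hc : Continuous fun a : (E d × E l × E l) × (Fin m → ℝ) =>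
          (a.1.1, a.1.2.1, a.1.2.2, a.2) := by fun_prop
      filter_upwards [hc.continuousAt.preimage_mem_nhds (hWo.mem_nhds hW)]
        with ⟨⟨x, y, u⟩, s⟩ ha h1 h2 h3
      exact hcalmW x y u s ha ⟨⟨h1, h3⟩, h2⟩)
  obtain ⟨heq1, heq2, heq3⟩ := gradient_equations_of_fritzJohnM hF hf hg hFJ
  obtain ⟨hlam, hlam0, -, hsign⟩ := hFJ
  have hlam0' : ∀ i, g i (xb, yb) ≠ 0 → lam i = 0 := fun i hi =>
    hlam0 i (lt_of_le_of_ne (hgy i) hi)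
  rcases hr with rfl | ⟨rfl, hne⟩
  · refine ⟨lamt, lam, mu, nu, hlamt, hlam, hlam0', fun i hi => (hsign i).2.1 hi.1,
      ⟨?_, ?_, ?_⟩, fun i _ hi => (hsign i).1 hi, fun i _ _ => (hsign i).2.2⟩
    · simpa only [one_smul] using heq1
    · simpa only [one_smul] using heq2
    · simpa only [one_smul] using heq3
  · refine absurd (hnnamcq lam mu nu hlam hlam0'
      (fun i hi => (hsign i).2.1 (lt_of_le_of_ne (hcomp i).2.1 hi)) ?_ ?_ ?_
      (fun i _ hi => (hsign i).1 hi) fun i _ _ => (hsign i).2.2) hne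
    · simpa only [zero_smul, zero_add] using heq1
    · simpa only [zero_smul, zero_add] using heq2
    · simpa only [zero_smul, zero_add] using heq3
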